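/- Let u, v be C² functions on ℝⁿ with v = -Δu ≥ 0, Δ²u = |x|^a u^p, u ≥ 0, and suppose for all R > 1: ∫_{B_R} |x|^a u^{p+1} ≤ C₁ R^{n-(4p+a)/(p-1)}, ∫_{B_{2R}} |Δu| ≤ C₂ R^{n-(2p+2+a)/(p-1)}, and ∫_{B_{2R}\B_R} u ≤ C₃ R^{n-(a+4)/(p-1)}, with u bounded. Then there exists C > 0 with ∫_{B_R} |Δu|² ≤ C R^{n-(4p+a)/(p-1)} for all R > 1. -/

import Mathlib

open MeasureTheory

/-- The Laplacian of a function on Euclidean space. -/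
noncomputable def laplacian {n : ℕ} (u : EuclideanSpace ℝ (Fin n) → ℝ)
    (x : EuclideanSpace ℝ (Fin n)) : ℝ :=
  ∑ i : Fin n, iteratedFDeriv ℝ 2 u x ![EuclideanSpace.single i 1, EuclideanSpace.single i 1]

namespace L2Est

/-- partial derivative -/
noncomputable def D {n : ℕ} (i : Fin n) (f : EuclideanSpace ℝ (Fin n) → ℝ)
    (x : EuclideanSpace ℝ (Fin n)) : ℝ :=
  fderiv ℝ f x (EuclideanSpace.single i 1)

variable {n : ℕ}

local notation "E" => EuclideanSpace ℝ (Fin n)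

lemma D_contDiff {k m : ℕ} (h : k + 1 ≤ m) (i : Fin n) {f : E → ℝ} (hf : ContDiff ℝ m f) :
    ContDiff ℝ k (D i f) := by
  unfold D
  have h1 : ContDiff ℝ k (fderiv ℝ f) := hf.fderiv_right (by exact_mod_cast h)
  exact h1.clm_apply contDiff_const

lemma lap_eq {m : ℕ} (hm : 2 ≤ m) {f : E → ℝ} (hf : ContDiff ℝ m f) (x : E) :
    laplacian f x = ∑ i, D i (D i f) x := by
  unfold laplacian
  refine Finset.sum_congr rfl fun i _ => ?_
  rw [iteratedFDeriv_two_apply]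
  have h1 : ContDiff ℝ 1 (fderiv ℝ f) := hf.fderiv_right (by exact_mod_cast hm)
  have h2 : DifferentiableAt ℝ (fderiv ℝ f) x := (h1.differentiable (by simp)) x
  unfold D
  rw [fderiv_clm_apply h2 (by fun_prop)]
  simp

lemma D_mul (i : Fin n) {f g : E → ℝ} {x : E} (hf : DifferentiableAt ℝ f x)
    (hg : DifferentiableAt ℝ g x) :
    D i (fun y => f y * g y) x = f x * D i g x + D i f x * g x := by
  unfold D
  rw [fderiv_fun_mul hf hg]
  simp [mul_comm]

lemma D_add (i : Fin n) {f g : E → ℝ} {x : E} (hf : DifferentiableAt ℝ f x)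
    (hg : DifferentiableAt ℝ g x) :
    D i (fun y => f y + g y) x = D i f x + D i g x := by
  unfold D
  rw [fderiv_fun_add hf hg]
  simp

lemma D_sub (i : Fin n) {f g : E → ℝ} {x : E} (hf : DifferentiableAt ℝ f x)
    (hg : DifferentiableAt ℝ g x) :
    D i (fun y => f y - g y) x = D i f x - D i g x := by
  unfold D
  rw [fderiv_fun_sub hf hg]
  simp

lemma D_cmul (i : Fin n) (c : ℝ) (f : E → ℝ) (x : E) :
    D i (fun y => c * f y) x = c * D i f x := by
  unfold D
  have := congrFun (fderiv_const_smul_field (𝕜 := ℝ) (f := f) c) x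
  have h2 : (fun y => c * f y) = c • f := rfl
  rw [h2, this]
  simp

lemma D_scale (i : Fin n) (c r : ℝ) (f : E → ℝ) :
    D i (fun y => c * f (r • y)) = fun x => (c * r) * D i f (r • x) := by
  funext x
  rw [D_cmul i c (fun y => f (r • y))]
  unfold D
  rw [fderiv_comp_smul]
  simp [mul_assoc]

lemma D_compact (i : Fin n) {f : E → ℝ} (hf : HasCompactSupport f) : HasCompactSupport (D i f) :=
  hf.fderiv_apply ℝ _

lemma D_tsupport (i : Fin n) (f : E → ℝ) : tsupport (D i f) ⊆ tsupport f :=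
  tsupport_fderiv_apply_subset ℝ _

lemma integral_D (i : Fin n) {f : E → ℝ} (hf : ContDiff ℝ 1 f) (hc : HasCompactSupport f) :
    Integrable (D i f) ∧ ∫ x, D i f x = 0 := by
  have hD : Integrable (D i f) :=
    ((D_contDiff (k := 0) (m := 1) le_rfl i (by exact_mod_cast hf)).continuous).integrable_of_hasCompactSupport
      (D_compact i hc)
  refine ⟨hD, ?_⟩
  have := integral_mul_fderiv_eq_neg_fderiv_mul_of_integrable (𝕜 := ℝ) (μ := (volume : Measure E))
    (f := fun _ => (1:ℝ)) (g := f) (v := EuclideanSpace.single i 1) (by simp)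
    (by simp only [one_mul]; exact hD) (by simpa using hf.continuous.integrable_of_hasCompactSupport hc)
    (by intros; fun_prop) (fun x _ => hf.differentiable (by simp) x)
  simp only [one_mul] at this
  refine Eq.trans this ?_
  simp

/-- Scaled cutoffs. -/
lemma exists_cutoff : ∃ K : ℝ, 0 ≤ K ∧ ∀ R : ℝ, 0 < R → ∃ η χ : E → ℝ,
    ContDiff ℝ 4 η ∧ ContDiff ℝ 4 χ ∧ HasCompactSupport η ∧ HasCompactSupport χ ∧
    (∀ x, 0 ≤ η x ∧ η x ≤ 1) ∧ (∀ x ∈ Metric.ball (0:E) R, η x = 1) ∧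
    (∀ x ∉ Metric.ball (0:E) (2*R), η x = 0 ∧ χ x = 0 ∧
      ∑ i, D i (D i (fun y => η y * η y)) x = 0 ∧ ∑ i, D i (D i χ) x = 0) ∧
    (∀ x ∈ Metric.ball (0:E) R, ∑ i, D i (D i χ) x = 0) ∧
    (∀ x, χ x = ∑ i, (D i η x)^2) ∧ (∀ x, |χ x| ≤ K * R⁻¹^2) ∧
    (∀ x, |∑ i, D i (D i (fun y => η y * η y)) x| ≤ K * R⁻¹^2) ∧
    (∀ x, |∑ i, D i (D i χ) x| ≤ K * R⁻¹^4) := by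
  let b : ContDiffBump (0 : E) := ⟨1, 3/2, by norm_num, by norm_num⟩
  set η : E → ℝ := fun x => b x with hη
  have hηs : ContDiff ℝ (6 : ℕ) η := b.contDiff
  have hηt : tsupport η ⊆ Metric.ball 0 2 := by
    rw [show tsupport η = tsupport b from rfl, b.tsupport_eq]
    exact Metric.closedBall_subset_ball (by norm_num [b])
  have hηc : HasCompactSupport η := b.hasCompactSupport
  have hη1 : ∀ x ∈ Metric.ball (0:E) 1, η x = 1 := fun x hx =>
    b.one_of_mem_closedBall (Metric.ball_subset_closedBall hx)
  set χ : E → ℝ := fun x => ∑ i, (D i η x)^2 with hχ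
  have hχs : ContDiff ℝ (5 : ℕ) χ := by
    refine ContDiff.sum fun i _ => ?_
    exact (D_contDiff (by norm_num) i hηs).pow 2
  have hχt : tsupport χ ⊆ tsupport η := by
    refine closure_minimal ?_ (isClosed_tsupport _)
    intro x hx
    by_contra hc
    apply hx
    refine Finset.sum_eq_zero fun i _ => ?_
    have : D i η x = 0 := image_eq_zero_of_notMem_tsupport (fun h => hc (D_tsupport i _ h))
    simp [this]
  have hχc : HasCompactSupport χ := hηc.of_isClosed_subset (isClosed_tsupport _) hχt
  set φ : E → ℝ := fun y => η y * η y with hφ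
  have hφs : ContDiff ℝ (6 : ℕ) φ := hηs.mul hηs
  have hφt : tsupport φ ⊆ tsupport η := tsupport_mul_subset_left
  have hφc : HasCompactSupport φ := hηc.of_isClosed_subset (isClosed_tsupport _) hφt
  have hDDz : ∀ f : E → ℝ, tsupport f ⊆ tsupport η → ∀ x ∉ Metric.ball (0:E) 2,
      ∑ i, D i (D i f) x = 0 := by
    intro f hf x hx
    refine Finset.sum_eq_zero fun i _ => image_eq_zero_of_notMem_tsupport fun h => hx ?_
    exact hηt (hf (D_tsupport i _ (D_tsupport i _ h)))
  have hbd : ∀ f : E → ℝ, ContDiff ℝ (2:ℕ) f → HasCompactSupport f →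
      ∃ C, ∀ x, |∑ i, D i (D i f) x| ≤ C := by
    intro f hf hfc
    have hcont : Continuous (fun x => ∑ i, D i (D i f) x) := by
      refine continuous_finsetSum _ fun i _ => ?_
      exact (D_contDiff (k := 0) (m := 1) le_rfl i (D_contDiff le_rfl i hf)).continuous
    have hs : HasCompactSupport (fun x => ∑ i, D i (D i f) x) := by
      refine hfc.of_isClosed_subset (isClosed_tsupport _) ?_
      refine closure_minimal ?_ (isClosed_tsupport _)
      intro x hx
      by_contra hc
      apply hx
      exact Finset.sum_eq_zero fun i _ => image_eq_zero_of_notMem_tsupport fun h => hc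
        (D_tsupport i _ (D_tsupport i _ h))
    obtain ⟨C, hC⟩ := hcont.bounded_above_of_compact_support hs
    exact ⟨C, hC⟩
  obtain ⟨K1, hK1⟩ := hχs.continuous.bounded_above_of_compact_support hχc
  obtain ⟨K2, hK2⟩ := hbd φ (hφs.of_le (by norm_cast)) hφc
  obtain ⟨K3, hK3⟩ := hbd χ (hχs.of_le (by norm_cast)) hχc
  refine ⟨|K1| + |K2| + |K3|, by positivity, fun R hR => ?_⟩
  set r := R⁻¹ with hr
  have hrpos : 0 < r := inv_pos.2 hR
  have hmem : ∀ (x : E) (s : ℝ), r • x ∈ Metric.ball (0:E) s ↔ x ∈ Metric.ball (0:E) (s * R) := by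
    intro x s
    rw [mem_ball_zero_iff, mem_ball_zero_iff, norm_smul, Real.norm_of_nonneg hrpos.le, hr,
      inv_mul_lt_iff₀ hR, mul_comm]
  have hmem1 : ∀ x ∈ Metric.ball (0:E) R, r • x ∈ Metric.ball (0:E) 1 := fun x hx => by
    rw [hmem]; simpa using hx
  have hmem2 : ∀ x ∉ Metric.ball (0:E) (2*R), r • x ∉ Metric.ball (0:E) 2 := fun x hx => by
    rw [hmem]; exact hx
  have hsc : ContDiff ℝ 4 (fun x : E => r • x) := contDiff_const_smul r
  have hcs : ∀ f : E → ℝ, HasCompactSupport f → HasCompactSupport (fun x => f (r • x)) :=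
    fun f hf => hf.comp_homeomorph (Homeomorph.smulOfNeZero r hrpos.ne')
  have hL : ∀ (c : ℝ) (f : E → ℝ) (x : E), ∑ i, D i (D i (fun y => c * f (r • y))) x
      = c * r^2 * ∑ i, D i (D i f) (r • x) := by
    intro c f x
    rw [Finset.mul_sum]
    refine Finset.sum_congr rfl fun i _ => ?_
    rw [D_scale, D_scale]
    ring
  have hLφ : ∀ x, ∑ i, D i (D i (fun y => η (r • y) * η (r • y))) x
      = r^2 * ∑ i, D i (D i φ) (r • x) := by
    intro x
    have := hL 1 φ x
    simpa [hφ] using this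
  have hDη : ∀ i x, D i (fun y => η (r • y)) x = r * D i η (r • x) := by
    intro i x
    have := congrFun (D_scale i 1 r η) x
    simpa using this
  have hηz : ∀ x ∉ Metric.ball (0:E) 2, η x = 0 := fun x hx =>
    image_eq_zero_of_notMem_tsupport fun h => hx (hηt h)
  have hχz : ∀ x ∉ Metric.ball (0:E) 2, χ x = 0 := fun x hx =>
    image_eq_zero_of_notMem_tsupport fun h => hx (hηt (hχt h))
  refine ⟨fun x => η (r • x), fun x => r^2 * χ (r • x), ?_, ?_, hcs _ hηc, ?_, ?_, ?_, ?_, ?_, ?_,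
    ?_, ?_, ?_⟩
  · exact (hηs.of_le (by norm_cast)).comp hsc
  · exact contDiff_const.mul ((hχs.of_le (by norm_cast)).comp hsc)
  · exact (hcs _ hχc).mul_left
  · exact fun x => ⟨b.nonneg, b.le_one⟩
  · exact fun x hx => hη1 _ (hmem1 x hx)
  · intro x hx
    refine ⟨hηz _ (hmem2 x hx), ?_, ?_, ?_⟩
    · simp [hχz _ (hmem2 x hx)]
    · rw [hLφ, hDDz φ hφt _ (hmem2 x hx), mul_zero]
    · rw [hL, hDDz χ hχt _ (hmem2 x hx), mul_zero]
  · intro x hx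
    rw [hL]
    have hz : ∀ (f : E → ℝ) (c : ℝ), (∀ y ∈ Metric.ball (0:E) 1, f y = c) →
        ∀ i, ∀ y ∈ Metric.ball (0:E) 1, D i f y = 0 := by
      intro f c hf i y hy
      have : f =ᶠ[nhds y] fun _ => c := by
        filter_upwards [Metric.isOpen_ball.mem_nhds hy] with z hz using hf z hz
      unfold D
      rw [this.fderiv_eq]
      simp
    have h1 : ∀ y ∈ Metric.ball (0:E) 1, χ y = 0 := by
      intro y hy
      exact Finset.sum_eq_zero fun i _ => by rw [hz η 1 hη1 i y hy]; simp
    rw [Finset.sum_eq_zero fun i _ => hz _ 0 (hz χ 0 h1 i) i _ (hmem1 x hx), mul_zero]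
  · intro x
    simp only [hDη, hχ, mul_pow, Finset.mul_sum]
  · intro x
    rw [abs_mul, abs_of_nonneg (by positivity : 0 ≤ r^2), mul_comm]
    have := hK1 (r • x)
    rw [Real.norm_eq_abs] at this
    have h2 : |χ (r • x)| ≤ |K1| + |K2| + |K3| := by
      linarith [le_abs_self K1, abs_nonneg K2, abs_nonneg K3]
    gcongr
  · intro x
    rw [hLφ, abs_mul, abs_of_nonneg (by positivity : 0 ≤ r^2), mul_comm]
    have := hK2 (r • x)
    have h2 : |∑ i, D i (D i φ) (r • x)| ≤ |K1| + |K2| + |K3| := by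
      linarith [le_abs_self K2, abs_nonneg K1, abs_nonneg K3]
    gcongr
  · intro x
    rw [hL, abs_mul, abs_of_nonneg (by positivity : 0 ≤ r^2 * r^2), mul_comm]
    have := hK3 (r • x)
    have h2 : |∑ i, D i (D i χ) (r • x)| ≤ |K1| + |K2| + |K3| := by
      linarith [le_abs_self K3, abs_nonneg K1, abs_nonneg K2]
    have h4 : r^2 * r^2 = r^4 := by ring
    rw [h4]
    gcongr

/-- The integrated divergence identity. -/
lemma div_identity {u w η χ : E → ℝ} (hu : ContDiff ℝ 4 u) (hw : ContDiff ℝ 2 w)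
    (hη : ContDiff ℝ 4 η) (hχ : ContDiff ℝ 4 χ) (hηc : HasCompactSupport η)
    (hχc : HasCompactSupport χ) (hwu : ∀ x, w x = ∑ i, D i (D i u) x) :
    ∃ Z : E → ℝ, Integrable Z ∧ ∫ x, Z x = 0 ∧ ∀ x, Z x =
      η x ^ 2 * w x ^ 2 - η x ^ 2 * u x * (∑ i, D i (D i w) x)
       + 4 * η x * w x * (∑ i, D i u x * D i η x)
       + u x * w x * (∑ i, D i (D i (fun y => η y * η y)) x)
       + 8 * (χ x * (∑ i, D i u x ^ 2) + χ x * u x * w x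
         - 1/2 * u x ^ 2 * (∑ i, D i (D i χ) x)) := by
  set φ : E → ℝ := fun y => η y * η y with hφ
  have hφs : ContDiff ℝ 4 φ := hη.mul hη
  have hφc : HasCompactSupport φ := hηc.mul_left
  have u1 : ContDiff ℝ 1 u := hu.of_le (by norm_cast)
  have w1 : ContDiff ℝ 1 w := hw.of_le (by norm_cast)
  have φ1 : ContDiff ℝ 1 φ := hφs.of_le (by norm_cast)
  have χ1 : ContDiff ℝ 1 χ := hχ.of_le (by norm_cast)
  have Du : ∀ i, ContDiff ℝ 1 (D i u) := fun i => D_contDiff (k := 1) (m := 4) (by norm_num) i hu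
  have Dw : ∀ i, ContDiff ℝ 1 (D i w) := fun i => D_contDiff (k := 1) (m := 2) (by norm_num) i hw
  have Dφ : ∀ i, ContDiff ℝ 1 (D i φ) := fun i => D_contDiff (k := 1) (m := 4) (by norm_num) i hφs
  have Dχ : ∀ i, ContDiff ℝ 1 (D i χ) := fun i => D_contDiff (k := 1) (m := 4) (by norm_num) i hχ
  let F : Fin n → E → ℝ := fun i x =>
    φ x * (w x * D i u x - u x * D i w x) + D i φ x * (u x * w x)
      + (χ x * (8 * (u x * D i u x)) - D i χ x * (4 * (u x * u x)))
  have hF1 : ∀ i, ContDiff ℝ 1 (F i) := fun i => by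
    have := Du i; have := Dw i; have := Dφ i; have := Dχ i
    fun_prop
  have hFc : ∀ i, HasCompactSupport (F i) := fun i => by
    refine HasCompactSupport.add (HasCompactSupport.add ?_ ?_) (HasCompactSupport.sub ?_ ?_)
    · exact hφc.mul_right
    · exact (D_compact i hφc).mul_right
    · exact hχc.mul_right
    · exact (D_compact i hχc).mul_right
  refine ⟨fun x => ∑ i, D i (F i) x, integrable_finsetSum _ fun i _ =>
    (integral_D i (hF1 i) (hFc i)).1, ?_, ?_⟩
  · rw [integral_finsetSum _ fun i _ => (integral_D i (hF1 i) (hFc i)).1]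
    exact Finset.sum_eq_zero fun i _ => (integral_D i (hF1 i) (hFc i)).2
  · intro x
    have du : DifferentiableAt ℝ u x := u1.differentiable (by simp) x
    have dw : DifferentiableAt ℝ w x := w1.differentiable (by simp) x
    have dφ : DifferentiableAt ℝ φ x := φ1.differentiable (by simp) x
    have dχ : DifferentiableAt ℝ χ x := χ1.differentiable (by simp) x
    have dη : DifferentiableAt ℝ η x := hη.differentiable (by simp) x
    have key : ∀ i, D i (F i) x = φ x * w x * D i (D i u) x - φ x * u x * D i (D i w) x
        + 4 * η x * w x * (D i u x * D i η x) + u x * w x * D i (D i φ) x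
        + 8 * χ x * D i u x ^ 2 + 8 * χ x * u x * D i (D i u) x
        - 4 * u x ^ 2 * D i (D i χ) x := by
      intro i
      have dDu : DifferentiableAt ℝ (D i u) x := (Du i).differentiable (by simp) x
      have dDw : DifferentiableAt ℝ (D i w) x := (Dw i).differentiable (by simp) x
      have dDφ : DifferentiableAt ℝ (D i φ) x := (Dφ i).differentiable (by simp) x
      have dDχ : DifferentiableAt ℝ (D i χ) x := (Dχ i).differentiable (by simp) x
      have e1 : D i φ x = 2 * η x * D i η x := by
        rw [hφ, D_mul i dη dη]; ring
      simp only [F]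
      rw [D_add i (by fun_prop) (by fun_prop), D_add i (by fun_prop) (by fun_prop),
        D_sub i (by fun_prop) (by fun_prop), D_mul i dφ (by fun_prop),
        D_sub i (by fun_prop) (by fun_prop), D_mul i dw dDu, D_mul i du dDw,
        D_mul i dDφ (by fun_prop), D_mul i du dw, D_mul i dχ (by fun_prop),
        D_cmul i 8 (fun y => u y * D i u y), D_mul i du dDu, D_mul i dDχ (by fun_prop),
        D_cmul i 4 (fun y => u y * u y), D_mul i du du, e1]
      ring
    have hφx : φ x = η x ^ 2 := by rw [hφ]; ring
    simp only [key, Finset.sum_add_distrib, Finset.sum_sub_distrib, ← Finset.mul_sum]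
    rw [← hwu x, hφx]
    ring

/-- Pointwise bound. -/
lemma pointwise {u w η χ : E → ℝ} {M k2 k4 g Lφ Lχ : ℝ} (x : E)
    (hk2 : 0 ≤ k2) (hu0 : 0 ≤ u x) (huM : u x ≤ M)
    (hχ : χ x = ∑ i, (D i η x)^2) (hχk : |χ x| ≤ k2) (hφ : |Lφ| ≤ k2) (hLχ : |Lχ| ≤ k4) :
    1/2 * (η x ^ 2 * w x ^ 2) ≤
      (η x ^ 2 * w x ^ 2 - η x ^ 2 * u x * g
       + 4 * η x * w x * (∑ i, D i u x * D i η x)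
       + u x * w x * Lφ
       + 8 * (χ x * (∑ i, D i u x ^ 2) + χ x * u x * w x
         - 1/2 * u x ^ 2 * Lχ)) + η x ^ 2 * u x * g + 9 * M * k2 * |w x| + 4 * M * k4 * u x := by
  have hCS := Finset.sum_mul_sq_le_sq_mul_sq Finset.univ (fun i => D i u x) (fun i => D i η x)
  rw [← hχ] at hCS
  set S := ∑ i, D i u x * D i η x
  set G := ∑ i, D i u x ^ 2
  have h1 : -(1/2 * (η x ^ 2 * w x ^ 2)) ≤ 4 * η x * w x * S + 8 * (χ x * G) := by
    nlinarith [sq_nonneg (η x * w x + 4 * S)]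
  have h2 : |u x * w x * Lφ| ≤ M * k2 * |w x| := by
    rw [abs_mul, abs_mul, abs_of_nonneg hu0]
    calc u x * |w x| * |Lφ| ≤ M * |w x| * k2 := by gcongr; exact mul_nonneg (hu0.trans huM) (abs_nonneg _)
      _ = _ := by ring
  have h3 : |χ x * u x * w x| ≤ M * k2 * |w x| := by
    rw [abs_mul, abs_mul, abs_of_nonneg hu0]
    calc |χ x| * u x * |w x| ≤ k2 * M * |w x| := by gcongr
      _ = _ := by ring
  have h4 : |u x ^ 2 * Lχ| ≤ M * k4 * u x := by
    rw [abs_mul, abs_of_nonneg (sq_nonneg _)]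
    calc u x ^ 2 * |Lχ| = u x * u x * |Lχ| := by ring
      _ ≤ M * u x * k4 := by gcongr; exact mul_nonneg (hu0.trans huM) hu0
      _ = _ := by ring
  have := (abs_le.1 h2).1
  have := (abs_le.1 h3).1
  have := (abs_le.1 h4).2
  linarith

end L2Est

/-- L² estimate on balls for Δu: under the stated decay hypotheses for a bounded
nonnegative solution of Δ²u = |x|^a u^p with -Δu ≥ 0, one has
∫_{B_R} |Δu|² ≤ C R^{n-(4p+a)/(p-1)} for all R > 1. -/
theorem L2_estimate_laplacian (n : ℕ) (p a C₁ C₂ C₃ : ℝ) (hn : 5 ≤ n) (hp : 1 < p) (ha : 0 ≤ a)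
    (u : EuclideanSpace ℝ (Fin n) → ℝ) (hu : ContDiff ℝ 4 u)
    (hupos : ∀ x, 0 ≤ u x) (hbdd : ∃ M : ℝ, ∀ x, u x ≤ M)
    (hsuper : ∀ x, 0 ≤ -laplacian u x)
    (heq : ∀ x, laplacian (laplacian u) x = ‖x‖ ^ a * u x ^ p)
    (hdecay1 : ∀ R > (1 : ℝ),
      ∫ x in Metric.ball (0 : EuclideanSpace ℝ (Fin n)) R, ‖x‖ ^ a * u x ^ (p + 1) ≤
        C₁ * R ^ ((n : ℝ) - (4 * p + a) / (p - 1)))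
    (hdecay2 : ∀ R > (1 : ℝ),
      ∫ x in Metric.ball (0 : EuclideanSpace ℝ (Fin n)) (2 * R), |laplacian u x| ≤
        C₂ * R ^ ((n : ℝ) - (2 * p + 2 + a) / (p - 1)))
    (hdecay3 : ∀ R > (1 : ℝ),
      ∫ x in Metric.ball (0 : EuclideanSpace ℝ (Fin n)) (2 * R) \
          Metric.ball (0 : EuclideanSpace ℝ (Fin n)) R, u x ≤
        C₃ * R ^ ((n : ℝ) - (a + 4) / (p - 1))) :
    ∃ C > 0, ∀ R > (1 : ℝ),
      ∫ x in Metric.ball (0 : EuclideanSpace ℝ (Fin n)) R, |laplacian u x| ^ 2 ≤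
        C * R ^ ((n : ℝ) - (4 * p + a) / (p - 1)) := by
  classical
  obtain ⟨M, hM⟩ := hbdd
  have hM0 : 0 ≤ M := (hupos 0).trans (hM 0)
  obtain ⟨K, hK0, hcut⟩ := L2Est.exists_cutoff (n := n)
  set e : ℝ := (n : ℝ) - (4 * p + a) / (p - 1) with he
  have hp1 : p - 1 ≠ 0 := by linarith
  have he2 : (n : ℝ) - (2 * p + 2 + a) / (p - 1) = e + 2 := by
    rw [he]; field_simp; ring
  have he4 : (n : ℝ) - (a + 4) / (p - 1) = e + 4 := by
    rw [he]; field_simp; ring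
  rw [he2] at hdecay2
  rw [he4] at hdecay3
  have hlap : ∀ x, laplacian u x = ∑ i, L2Est.D i (L2Est.D i u) x := fun x =>
    L2Est.lap_eq (m := 4) (by norm_num) hu x
  have hw : ContDiff ℝ 2 (laplacian u) := by
    have : laplacian u = fun x => ∑ i, L2Est.D i (L2Est.D i u) x := funext hlap
    rw [this]
    exact ContDiff.sum fun i _ => L2Est.D_contDiff (k := 2) (m := 3) (by norm_num) i
      (L2Est.D_contDiff (k := 3) (m := 4) (by norm_num) i hu)
  have hlapw : ∀ x, ∑ i, L2Est.D i (L2Est.D i (laplacian u)) x = ‖x‖ ^ a * u x ^ p := fun x => by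
    rw [← heq x, L2Est.lap_eq (m := 2) le_rfl hw x]
  have hcu : Continuous u := hu.continuous
  have hcw : Continuous (laplacian u) := hw.continuous
  have hch : Continuous (fun x : EuclideanSpace ℝ (Fin n) => ‖x‖ ^ a * u x ^ (p + 1)) :=
    (continuous_norm.rpow_const fun _ => Or.inr ha).mul
      (hcu.rpow_const fun _ => Or.inr (by linarith))
  have hIntOn : ∀ (f : EuclideanSpace ℝ (Fin n) → ℝ), Continuous f → ∀ r : ℝ,
      IntegrableOn f (Metric.ball 0 r) := fun f hf r =>
    (hf.continuousOn.integrableOn_compact (isCompact_closedBall 0 r)).mono_set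
      Metric.ball_subset_closedBall
  refine ⟨1 + 2 * (|C₁| * 2 ^ e + 9 * M * K * |C₂| + 4 * M * K * |C₃|), by positivity,
    fun R hR => ?_⟩
  have hR0 : 0 < R := by linarith
  obtain ⟨η, χ, hη, hχ, hηc, hχc, hη01, hη1, hout, hin, hχeq, hχK, hφK, hLχK⟩ := hcut R hR0
  obtain ⟨Z, hZi, hZ0, hZ⟩ := L2Est.div_identity hu hw hη hχ hηc hχc hlap
  set B := Metric.ball (0 : EuclideanSpace ℝ (Fin n)) R with hB
  set B2 := Metric.ball (0 : EuclideanSpace ℝ (Fin n)) (2 * R) with hB2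
  have hBm : MeasurableSet B := Metric.isOpen_ball.measurableSet
  have hB2m : MeasurableSet B2 := Metric.isOpen_ball.measurableSet
  have hBB : B ⊆ B2 := Metric.ball_subset_ball (by linarith)
  have i0 : Integrable (B.indicator fun x => |laplacian u x| ^ 2) :=
    (integrable_indicator_iff hBm).2 (hIntOn _ (by fun_prop) R)
  have i1 : Integrable (B2.indicator fun x => ‖x‖ ^ a * u x ^ (p + 1)) :=
    (integrable_indicator_iff hB2m).2 (hIntOn _ hch _)
  have i2 : Integrable (B2.indicator fun x => |laplacian u x|) :=
    (integrable_indicator_iff hB2m).2 (hIntOn _ (by fun_prop) _)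
  have i3 : Integrable ((B2 \ B).indicator u) :=
    (integrable_indicator_iff (hB2m.diff hBm)).2 ((hIntOn _ hcu _).mono_set Set.sdiff_subset)
  have hmain : ∀ x, 1/2 * B.indicator (fun x => |laplacian u x| ^ 2) x ≤
      Z x + B2.indicator (fun x => ‖x‖ ^ a * u x ^ (p + 1)) x
        + 9 * M * (K * R⁻¹ ^ 2) * B2.indicator (fun x => |laplacian u x|) x
        + 4 * M * (K * R⁻¹ ^ 4) * (B2 \ B).indicator u x := by
    intro x
    have hg0 : 0 ≤ ‖x‖ ^ a * u x ^ (p + 1) :=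
      mul_nonneg (Real.rpow_nonneg (norm_nonneg _) _) (Real.rpow_nonneg (hupos x) _)
    have hug : u x * (‖x‖ ^ a * u x ^ p) = ‖x‖ ^ a * u x ^ (p + 1) := by
      rw [Real.rpow_add_one' (hupos x) (by linarith)]; ring
    by_cases hx2 : x ∈ B2
    · have hη2 : η x ^ 2 ≤ 1 := pow_le_one₀ (hη01 x).1 (hη01 x).2
      have hφh : η x ^ 2 * u x * (∑ i, L2Est.D i (L2Est.D i (laplacian u)) x)
          ≤ ‖x‖ ^ a * u x ^ (p + 1) := by
        rw [hlapw, mul_assoc, hug]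
        exact mul_le_of_le_one_left hg0 hη2
      by_cases hx : x ∈ B
      · have hpt := L2Est.pointwise (u := u) (w := laplacian u) (η := η) (χ := χ) (M := M)
          (k4 := 0) (g := ∑ i, L2Est.D i (L2Est.D i (laplacian u)) x)
          (Lχ := ∑ i, L2Est.D i (L2Est.D i χ) x) x
          (by positivity) (hupos x) (hM x) (hχeq x) (hχK x) (hφK x) (by rw [hin x hx]; simp)
        rw [← hZ x] at hpt
        have hn : x ∉ B2 \ B := fun h => h.2 hx
        rw [Set.indicator_of_mem hx, Set.indicator_of_mem hx2, Set.indicator_of_mem hx2,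
          Set.indicator_of_notMem hn]
        rw [hη1 x hx] at hpt hφh
        rw [sq_abs]
        linarith
      · have hpt := L2Est.pointwise (u := u) (w := laplacian u) (η := η) (χ := χ) (M := M)
          (g := ∑ i, L2Est.D i (L2Est.D i (laplacian u)) x) x
          (by positivity) (hupos x) (hM x) (hχeq x) (hχK x) (hφK x) (hLχK x)
        rw [← hZ x] at hpt
        have hn : x ∈ B2 \ B := ⟨hx2, hx⟩
        rw [Set.indicator_of_notMem hx, Set.indicator_of_mem hx2, Set.indicator_of_mem hx2,
          Set.indicator_of_mem hn]
        have : 0 ≤ 1/2 * (η x ^ 2 * laplacian u x ^ 2) := by positivity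
        linarith
    · have hx : x ∉ B := fun h => hx2 (hBB h)
      have hn : x ∉ B2 \ B := fun h => hx2 h.1
      rw [Set.indicator_of_notMem hx, Set.indicator_of_notMem hx2, Set.indicator_of_notMem hx2,
          Set.indicator_of_notMem hn]
      obtain ⟨q1, q2, q3, q4⟩ := hout x hx2
      rw [hZ x, q1, q2, q3, q4]
      simp
  have hI := integral_mono (i0.const_mul (1/2))
    (((hZi.add i1).add (i2.const_mul (9 * M * (K * R⁻¹ ^ 2)))).add
      (i3.const_mul (4 * M * (K * R⁻¹ ^ 4)))) hmain
  simp only [Pi.add_apply] at hI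
  rw [integral_add (by exact (hZi.add i1).add (i2.const_mul (9 * M * (K * R⁻¹ ^ 2))))
      (i3.const_mul (4 * M * (K * R⁻¹ ^ 4))),
    integral_add (by exact hZi.add i1) (i2.const_mul (9 * M * (K * R⁻¹ ^ 2))),
    integral_add hZi i1, hZ0, integral_const_mul, integral_const_mul, integral_const_mul,
    integral_indicator hBm, integral_indicator hB2m, integral_indicator hB2m,
    integral_indicator (hB2m.diff hBm)] at hI
  have d1 := hdecay1 (2 * R) (by linarith)
  have d2 := hdecay2 R hR
  have d3 := hdecay3 R hR
  rw [Real.mul_rpow (by norm_num) hR0.le] at d1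
  have r2 : R ^ (e + 2) = R ^ e * R ^ 2 := by
    rw [Real.rpow_add hR0]; norm_cast
  have r4 : R ^ (e + 4) = R ^ e * R ^ 4 := by
    rw [Real.rpow_add hR0]; norm_cast
  rw [r2] at d2
  rw [r4] at d3
  have hRe : 0 ≤ R ^ e := Real.rpow_nonneg hR0.le _
  have h2e : (0:ℝ) ≤ 2 ^ e := Real.rpow_nonneg (by norm_num) _
  have t1 : C₁ * (2 ^ e * R ^ e) ≤ |C₁| * 2 ^ e * R ^ e := by
    rw [mul_assoc]
    exact mul_le_mul_of_nonneg_right (le_abs_self _) (by positivity)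
  have t2 : 9 * M * (K * R⁻¹ ^ 2) * ∫ x in B2, |laplacian u x| ≤ 9 * M * K * |C₂| * R ^ e := by
    have : ∫ x in B2, |laplacian u x| ≤ |C₂| * (R ^ e * R ^ 2) :=
      d2.trans (mul_le_mul_of_nonneg_right (le_abs_self _) (by positivity))
    calc _ ≤ 9 * M * (K * R⁻¹ ^ 2) * (|C₂| * (R ^ e * R ^ 2)) := by gcongr
      _ = _ := by field_simp
  have t3 : 4 * M * (K * R⁻¹ ^ 4) * ∫ x in B2 \ B, u x ≤ 4 * M * K * |C₃| * R ^ e := by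
    have : ∫ x in B2 \ B, u x ≤ |C₃| * (R ^ e * R ^ 4) :=
      d3.trans (mul_le_mul_of_nonneg_right (le_abs_self _) (by positivity))
    calc _ ≤ 4 * M * (K * R⁻¹ ^ 4) * (|C₃| * (R ^ e * R ^ 4)) := by gcongr
      _ = _ := by field_simp
  linarith
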